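/- arXiv:1312.5192 — 2 statements merged into one kernel-verified Lean document; each statement's English description precedes it below -/
import Mathlib

section
/- Let f₂ ∈ ℝ^V with ‖f₂‖₂ = 1 and S(f₂) ≠ 0, and set f₁ := f₂ / G(f₂)^{1/p}. Fix subgradients r₂ ∈ ∂R₂(f₂) = ∂R₂(f₁) and s₁ ∈ ∂S₁(f₂) = ∂S₁(f₁), let c ≥ 0 and g ∈ ∂G(f₁). Suppose f₁ minimizes Φ_{f₁}^c over {u : G(u) ≤ 1}, and suppose further that either c = 0 or the subdifferential ∂G(f₁) is the singleton {g}. Then f₂ minimizes the function u ↦ R₁(u) − ⟨u, r₂⟩ + F(f₂)·(S₂(u) − ⟨u, s₁⟩) over {u : ‖u‖₂ ≤ 1}. -/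
open Finset Filter

/-- Euclidean inner product on `V → ℝ`. -/
def ip {V : Type*} [Fintype V] (f g : V → ℝ) : ℝ := ∑ i, f i * g i

/-- Euclidean norm on `V → ℝ`. -/
noncomputable def nrm {V : Type*} [Fintype V] (f : V → ℝ) : ℝ :=
  Real.sqrt (∑ i, (f i) ^ 2)

/-- The subdifferential of `A` at `f`:  `a ∈ subdiff A f` iff
`A u ≥ A f + ⟨a, u - f⟩` for all `u`. -/
def subdiff {V : Type*} [Fintype V] (A : (V → ℝ) → ℝ) (f : V → ℝ) : Set (V → ℝ) :=
  {a | ∀ u, A f + ip a (u - f) ≤ A u}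

/-- Positively one-homogeneous. -/
def PosOneHom {V : Type*} (A : (V → ℝ) → ℝ) : Prop :=
  ∀ ν : ℝ, 0 ≤ ν → ∀ f, A (ν • f) = ν * A f

/-- Positively `p`-homogeneous (real exponent, via `rpow`). -/
noncomputable def PosPHom {V : Type*} (p : ℝ) (A : (V → ℝ) → ℝ) : Prop :=
  ∀ ν : ℝ, 0 ≤ ν → ∀ f, A (ν • f) = ν ^ p * A f

/-- The inner objective `Φ_f^c` of RatioDCA-prox, with `F f = (R₁ f - R₂ f)/(S₁ f - S₂ f)`. -/
noncomputable def Phi {V : Type*} [Fintype V] (R1 R2 S1 S2 : (V → ℝ) → ℝ)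
    (f r2 s1 g : V → ℝ) (c : ℝ) (u : V → ℝ) : ℝ :=
  R1 u - ip u r2 + ((R1 f - R2 f) / (S1 f - S2 f)) * (S2 u - ip u s1) - c * ip u g


lemma ip_comm' {V : Type*} [Fintype V] (a b : V → ℝ) : ip a b = ip b a := by
  simp [ip, mul_comm]

lemma ip_add' {V : Type*} [Fintype V] (a b d : V → ℝ) : ip a (b + d) = ip a b + ip a d := by
  simp [ip, mul_add, Finset.sum_add_distrib]

lemma ip_smul' {V : Type*} [Fintype V] (a b : V → ℝ) (t : ℝ) : ip a (t • b) = t * ip a b := by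
  simp only [ip, Finset.mul_sum, Pi.smul_apply, smul_eq_mul]
  exact Finset.sum_congr rfl fun i _ => by ring

lemma ip_sub' {V : Type*} [Fintype V] (a b d : V → ℝ) : ip a (b - d) = ip a b - ip a d := by
  simp [ip, mul_sub, Finset.sum_sub_distrib]

lemma subadd_of {V : Type*} {A : (V → ℝ) → ℝ} (hc : ConvexOn ℝ Set.univ A)
    (hh : PosOneHom A) (x y : V → ℝ) : A (x + y) ≤ A x + A y := by
  have h := hc.2 (Set.mem_univ ((2:ℝ) • x)) (Set.mem_univ ((2:ℝ) • y))
    (by norm_num : (0:ℝ) ≤ 1/2) (by norm_num : (0:ℝ) ≤ 1/2) (by norm_num)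
  rw [hh 2 (by norm_num), hh 2 (by norm_num), smul_smul, smul_smul] at h
  norm_num at h
  linarith

lemma euler_one {V : Type*} [Fintype V] {A : (V → ℝ) → ℝ} (hh : PosOneHom A) {f r : V → ℝ}
    (hr : r ∈ subdiff A f) : ip f r = A f := by
  have h0 := hr ((0:ℝ) • f)
  have h2 := hr ((2:ℝ) • f)
  rw [hh _ (by norm_num), ip_sub', ip_smul'] at h0 h2
  rw [ip_comm']
  linarith

lemma euler_p {V : Type*} [Fintype V] {G : (V → ℝ) → ℝ} {p : ℝ} (hh : PosPHom p G)
    {f g : V → ℝ} (hf : G f = 1) (hg : g ∈ subdiff G f) : ip g f = p := by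
  have hd : HasDerivAt (fun t : ℝ => t ^ p - t * ip g f) (p * 1 ^ (p - 1) - 1 * ip g f) 1 :=
    (Real.hasDerivAt_rpow_const (Or.inl one_ne_zero)).sub ((hasDerivAt_id 1).mul_const _)
  have hm : IsLocalMin (fun t : ℝ => t ^ p - t * ip g f) 1 := by
    filter_upwards [lt_mem_nhds (zero_lt_one : (0:ℝ) < 1)] with t ht
    have h := hg (t • f)
    rw [hh t ht.le, ip_sub', ip_smul', hf] at h
    simp only [Real.one_rpow]
    linarith
  have := hm.hasDerivAt_eq_zero hd
  simp at this
  linarith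

/-- Extension step: a slope along a ray that is below `G` and above the slope of a known
subgradient is attained by some subgradient. -/
lemma exists_subgrad {V : Type*} [Fintype V] {G : (V → ℝ) → ℝ}
    (hG : ConvexOn ℝ Set.univ G) {f g u : V → ℝ} (hg : g ∈ subdiff G f) (hu : u ≠ 0) {a : ℝ}
    (ha : ip g u ≤ a) (hray : ∀ ε : ℝ, 0 < ε → G f + ε * a ≤ G (f + ε • u)) :
    ∃ g' ∈ subdiff G f, ip g' u = a := by
  classical
  let q : (V → ℝ) → ℝ → ℝ := fun w ε => (G (f + ε • w) - G f) / ε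
  let N : (V → ℝ) → ℝ := fun w => ⨅ ε : Set.Ioi (0:ℝ), q w ε
  have hlow : ∀ w (ε : ℝ), 0 < ε → ip g w ≤ q w ε := by
    intro w ε hε
    have h := hg (f + ε • w)
    rw [add_sub_cancel_left, ip_smul'] at h
    rw [le_div_iff₀ hε]
    linarith
  have hbdd : ∀ w, BddBelow (Set.range fun ε : Set.Ioi (0:ℝ) => q w ε) := by
    intro w
    refine ⟨ip g w, ?_⟩
    rintro _ ⟨ε, rfl⟩
    exact hlow w ε ε.2
  have : Nonempty (Set.Ioi (0:ℝ)) := ⟨⟨1, Set.mem_Ioi.2 one_pos⟩⟩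
  have hNle : ∀ w (ε : ℝ), 0 < ε → N w ≤ q w ε := fun w ε hε => ciInf_le (hbdd w) ⟨ε, hε⟩
  have hleN : ∀ w b, (∀ ε : ℝ, 0 < ε → b ≤ q w ε) → b ≤ N w :=
    fun w b h => le_ciInf fun ε => h ε ε.2
  have hhom1 : ∀ t : ℝ, 0 < t → ∀ w, t * N w ≤ N (t • w) := by
    intro t ht w
    apply hleN
    intro ε hε
    have h := hNle w (ε * t) (mul_pos hε ht)
    have e : q (t • w) ε = t * q w (ε * t) := by
      simp only [q, smul_smul]
      field_simp
    rw [e]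
    exact mul_le_mul_of_nonneg_left h ht.le
  have hhom : ∀ t : ℝ, 0 < t → ∀ w, N (t • w) = t * N w := by
    intro t ht w
    refine le_antisymm ?_ (hhom1 t ht w)
    have h := hhom1 t⁻¹ (inv_pos.2 ht) (t • w)
    rw [smul_smul, inv_mul_cancel₀ ht.ne', one_smul] at h
    rwa [inv_mul_le_iff₀ ht] at h
  have hsub : ∀ x y, N (x + y) ≤ N x + N y := by
    intro x y
    have key : ∀ s t : ℝ, 0 < s → 0 < t → N (x + y) ≤ q x s + q y t := by
      intro s t hs ht
      have hst : 0 < s + t := add_pos hs ht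
      refine (hNle (x + y) (s * t / (s + t)) (by positivity)).trans ?_
      have h := hG.2 (Set.mem_univ (f + s • x)) (Set.mem_univ (f + t • y))
        (by positivity : 0 ≤ t / (s + t)) (by positivity : 0 ≤ s / (s + t))
        (by field_simp; ring)
      have e : (t / (s + t)) • (f + s • x) + (s / (s + t)) • (f + t • y)
          = f + (s * t / (s + t)) • (x + y) := by
        ext i
        simp only [Pi.add_apply, Pi.smul_apply, smul_eq_mul]
        field_simp
        ring
      rw [e] at h
      simp only [smul_eq_mul] at h
      simp only [q]
      rw [div_le_iff₀ (by positivity)]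
      have e2 : ((G (f + s • x) - G f) / s + (G (f + t • y) - G f) / t) * (s * t / (s + t))
        = t / (s + t) * G (f + s • x) + s / (s + t) * G (f + t • y) - G f := by
        field_simp
        ring
      rw [e2]
      linarith
    have h1 : ∀ s : ℝ, 0 < s → N (x + y) - q x s ≤ N y := fun s hs =>
      hleN _ _ fun t ht => by linarith [key s t hs ht]
    have h2 : N (x + y) - N y ≤ N x := hleN _ _ fun s hs => by linarith [h1 s hs]
    linarith
  have haN : a ≤ N u := hleN _ _ fun ε hε => by
    rw [le_div_iff₀ hε]
    linarith [hray ε hε]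
  have hgN : ∀ w, ip g w ≤ N w := fun w => hleN _ _ fun ε hε => hlow w ε hε
  obtain ⟨L, hL1, hL2⟩ := exists_extension_of_le_sublinear
    (LinearPMap.mkSpanSingleton (K := ℝ) u a hu) N hhom hsub (by
      rintro ⟨x, hx⟩
      obtain ⟨t, rfl⟩ := Submodule.mem_span_singleton.1 hx
      rw [LinearPMap.mkSpanSingleton'_apply]
      simp only [RingHom.id_apply, smul_eq_mul]
      rcases lt_trichotomy t 0 with ht | ht | ht
      · refine le_trans ?_ (hgN _)
        rw [ip_smul']
        exact mul_le_mul_of_nonpos_left ha ht.le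
      · subst ht
        refine le_trans ?_ (hgN _)
        rw [ip_smul']
        simp
      · rw [hhom t ht]
        exact mul_le_mul_of_nonneg_left haN ht.le)
  have hip : ∀ w, ip (fun i => L (Pi.single i 1)) w = L w := by
    intro w
    rw [LinearMap.pi_apply_eq_sum_univ L w]
    simp only [ip, smul_eq_mul]
    refine Finset.sum_congr rfl fun i _ => ?_
    rw [mul_comm]
    congr 2
    ext j
    simp [Pi.single_apply, eq_comm]
  refine ⟨fun i => L (Pi.single i 1), ?_, ?_⟩
  · intro w
    rw [hip]
    have h := (hL2 (w - f)).trans (hNle (w - f) 1 one_pos)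
    simp only [q, one_smul, div_one, add_sub_cancel] at h
    linarith
  · rw [hip]
    have h := hL1 ⟨u, Submodule.mem_span_singleton_self u⟩
    rw [LinearPMap.mkSpanSingleton_apply] at h
    exact h

/-- conversely, if `f₁ = f₂ / G(f₂)^{1/p}` minimizes `Φ_{f₁}^c` over
`{u : G u ≤ 1}` and either `c = 0` or `∂G(f₁) = {g}` is a singleton, then `f₂`
minimizes the RatioDCA inner problem over the Euclidean unit ball. -/
theorem prox_termination_implies_ratioDCA_termination {V : Type*} [Fintype V]
    (p : ℝ) (hp : 1 ≤ p)
    (R1 R2 S1 S2 G : (V → ℝ) → ℝ)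
    (hR1conv : ConvexOn ℝ Set.univ R1) (hR2conv : ConvexOn ℝ Set.univ R2)
    (hS1conv : ConvexOn ℝ Set.univ S1) (hS2conv : ConvexOn ℝ Set.univ S2)
    (hR1hom : PosOneHom R1) (hR2hom : PosOneHom R2)
    (hS1hom : PosOneHom S1) (hS2hom : PosOneHom S2)
    (hRnonneg : ∀ u, 0 ≤ R1 u - R2 u) (hSnonneg : ∀ u, 0 ≤ S1 u - S2 u)
    (hGconv : ConvexOn ℝ Set.univ G) (hGnonneg : ∀ u, 0 ≤ G u)
    (hGhom : PosPHom p G) (hGzero : ∀ u, G u = 0 ↔ u = 0)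
    (f2 : V → ℝ) (hf2 : nrm f2 = 1) (hSf2 : S1 f2 - S2 f2 ≠ 0)
    (f1 : V → ℝ) (hf1 : f1 = (G f2 ^ ((1 : ℝ) / p))⁻¹ • f2)
    (c : ℝ) (hc : 0 ≤ c)
    (r2 : V → ℝ) (hr2 : r2 ∈ subdiff R2 f2) (hr2' : r2 ∈ subdiff R2 f1)
    (s1 : V → ℝ) (hs1 : s1 ∈ subdiff S1 f2) (hs1' : s1 ∈ subdiff S1 f1)
    (g : V → ℝ) (hg : g ∈ subdiff G f1)
    (hmin1 : G f1 ≤ 1 ∧ ∀ u, G u ≤ 1 →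
      Phi R1 R2 S1 S2 f1 r2 s1 g c f1 ≤ Phi R1 R2 S1 S2 f1 r2 s1 g c u)
    (hcase : c = 0 ∨ subdiff G f1 = {g}) :
    ∀ u, nrm u ≤ 1 →
      Phi R1 R2 S1 S2 f2 r2 s1 g 0 f2 ≤ Phi R1 R2 S1 S2 f2 r2 s1 g 0 u := by
  have hp0 : 0 < p := by linarith
  have hf2ne : f2 ≠ 0 := by
    rintro rfl
    simp [nrm] at hf2
  have hGf2 : 0 < G f2 := lt_of_le_of_ne (hGnonneg _) fun h => hf2ne ((hGzero _).1 h.symm)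
  have hroot : ∀ x : ℝ, 0 ≤ x → (x ^ ((1:ℝ) / p)) ^ p = x := by
    intro x hx
    rw [← Real.rpow_mul hx, one_div, inv_mul_cancel₀ hp0.ne', Real.rpow_one]
  have hnorm : ∀ h, h ≠ 0 → G ((G h ^ ((1:ℝ) / p))⁻¹ • h) = 1 := by
    intro h hh
    have hpos : 0 < G h := lt_of_le_of_ne (hGnonneg _) fun h' => hh ((hGzero _).1 h'.symm)
    have hs := Real.rpow_pos_of_pos hpos ((1:ℝ) / p)
    rw [hGhom _ (inv_pos.2 hs).le, Real.inv_rpow hs.le, hroot _ hpos.le,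
      inv_mul_cancel₀ hpos.ne']
  have hG1 : G f1 = 1 := by rw [hf1]; exact hnorm f2 hf2ne
  have hm : 0 < (G f2 ^ ((1 : ℝ) / p))⁻¹ := inv_pos.2 (Real.rpow_pos_of_pos hGf2 _)
  have hF : (R1 f1 - R2 f1) / (S1 f1 - S2 f1) = (R1 f2 - R2 f2) / (S1 f2 - S2 f2) := by
    rw [hf1, hR1hom _ hm.le, hR2hom _ hm.le, hS1hom _ hm.le, hS2hom _ hm.le,
      ← mul_sub, ← mul_sub, mul_div_mul_left _ _ hm.ne']
  have hSf1 : S1 f1 - S2 f1 ≠ 0 := by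
    rw [hf1, hS1hom _ hm.le, hS2hom _ hm.le, ← mul_sub]
    exact mul_ne_zero hm.ne' hSf2
  have hz1 : R1 f1 - ip f1 r2 + (R1 f1 - R2 f1) / (S1 f1 - S2 f1) * (S2 f1 - ip f1 s1) = 0 := by
    rw [euler_one hR2hom hr2', euler_one hS1hom hs1']
    field_simp
    ring
  have hz2 : R1 f2 - ip f2 r2 + (R1 f2 - R2 f2) / (S1 f2 - S2 f2) * (S2 f2 - ip f2 s1) = 0 := by
    rw [euler_one hR2hom hr2, euler_one hS1hom hs1]
    field_simp
    ring
  have hF0 : 0 ≤ (R1 f2 - R2 f2) / (S1 f2 - S2 f2) := div_nonneg (hRnonneg _) (hSnonneg _)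
  simp only [Phi] at hmin1 ⊢
  rw [hF] at hmin1 hz1
  generalize (R1 f2 - R2 f2) / (S1 f2 - S2 f2) = F at *
  rw [hz1] at hmin1
  rw [hz2]
  obtain ⟨Ψ, hΨ⟩ : ∃ Ψ : (V → ℝ) → ℝ,
    Ψ = fun u => R1 u - ip u r2 + F * (S2 u - ip u s1) := ⟨_, rfl⟩
  have hΨa : ∀ u, R1 u - ip u r2 + F * (S2 u - ip u s1) = Ψ u := fun u => by rw [hΨ]
  have hΨhom : PosOneHom Ψ := by
    intro ν hν f
    rw [← hΨa, ← hΨa, hR1hom ν hν, hS2hom ν hν, ip_comm', ip_comm' _ s1, ip_smul', ip_smul',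
      ip_comm' r2, ip_comm' s1]
    ring
  have hΨsub : ∀ x y, Ψ (x + y) ≤ Ψ x + Ψ y := by
    intro x y
    have h1 := subadd_of hR1conv hR1hom x y
    have h2 := mul_le_mul_of_nonneg_left (subadd_of hS2conv hS2hom x y) hF0
    rw [← hΨa, ← hΨa, ← hΨa, ip_comm' (x + y), ip_comm' (x + y), ip_add', ip_add',
      ip_comm' r2, ip_comm' s1, ip_comm' r2, ip_comm' s1]
    linarith
  simp only [hΨa] at hmin1 hz1 ⊢
  have he : ip g f1 = p := euler_p hGhom hG1 hg
  -- homogenized minimality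
  have hkey : ∀ h, c * ip g h - c * p * G h ^ ((1:ℝ) / p) ≤ Ψ h := by
    intro h
    by_cases hh : h = 0
    · subst hh
      have e1 : ip g (0 : V → ℝ) = 0 := by simp [ip]
      have e2 : Ψ 0 = 0 := by simpa using hΨhom 0 le_rfl 0
      rw [e1, e2, (hGzero 0).2 rfl, Real.zero_rpow (by positivity)]
      simp
    · have hpos : 0 < G h := lt_of_le_of_ne (hGnonneg _) fun h' => hh ((hGzero _).1 h'.symm)
      have hs := Real.rpow_pos_of_pos hpos ((1:ℝ) / p)
      have h1 := hmin1.2 _ (hnorm h hh).le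
      rw [hΨhom _ (inv_pos.2 hs).le, ip_comm' _ g, ip_comm' _ g, ip_smul', he] at h1
      generalize G h ^ ((1:ℝ) / p) = s at *
      have h2 := mul_le_mul_of_nonneg_left h1 hs.le
      have e3 : s * (s⁻¹ * Ψ h - c * (s⁻¹ * ip g h)) = Ψ h - c * ip g h := by
        field_simp
      rw [e3] at h2
      linarith
  intro u _
  suffices hfin : 0 ≤ Ψ u by simpa using hfin
  rcases hc.eq_or_lt with hc0 | hcpos
  · have := hkey u
    rw [← hc0] at this
    simpa using this
  have hsing : subdiff G f1 = {g} := hcase.resolve_left hcpos.ne'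
  by_contra! hneg
  have hu0 : u ≠ 0 := by
    rintro rfl
    have e2 : Ψ 0 = 0 := by simpa using hΨhom 0 le_rfl 0
    linarith
  have hq : Ψ u / c < 0 := div_neg_of_neg_of_pos hneg hcpos
  obtain ⟨g', hg', hgu⟩ := exists_subgrad hGconv hg hu0 (a := ip g u - Ψ u / c)
    (by linarith) (by
      intro ε hε
      have h1 := hkey (f1 + ε • u)
      have h2 := hΨsub f1 (ε • u)
      rw [hΨhom ε hε.le, hz1] at h2
      rw [ip_add', ip_smul', he] at h1
      have h3 : G (f1 + ε • u) ^ ((1:ℝ) / p) ≤ 1 + 1 / p * (G (f1 + ε • u) - 1) := by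
        have := rpow_one_add_le_one_add_mul_self (s := G (f1 + ε • u) - 1)
          (by linarith [hGnonneg (f1 + ε • u)]) (p := 1 / p) (by positivity)
          (by rw [div_le_one hp0]; exact hp)
        simpa using this
      have h4 := mul_le_mul_of_nonneg_left h3 (mul_nonneg hc hp0.le)
      have e4 : c * p * (1 + 1 / p * (G (f1 + ε • u) - 1))
          = c * p + c * (G (f1 + ε • u) - 1) := by
        field_simp
      rw [e4] at h4
      rw [hG1]
      refine le_of_mul_le_mul_left ?_ hcpos
      have e5 : c * (1 + ε * (ip g u - Ψ u / c)) = c + c * ε * ip g u - ε * Ψ u := by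
        field_simp
        ring
      rw [e5]
      linarith)
  rw [hsing] at hg'
  rw [Set.mem_singleton_iff.1 hg'] at hgu
  linarith
end

section
/- Let (V,w) be a finite undirected weighted graph and let S : ℝ^V → ℝ with balancing set function Ŝ satisfy one of the two conditions of the exact relaxation theorem: either (i) S is positively one-homogeneous, even, convex, satisfies S(f + α·1) = S(f) for all f, α, and Ŝ(A) := S(1_A), or (ii) S is the Lovasz extension of a nonnegative symmetric set function Ŝ with Ŝ(∅) = 0; in either case write S = S₁ − S₂ with S₁, S₂ convex and positively one-homogeneous, and assume Ŝ(B) > 0 for every ∅ ≠ B ⊊ V. Take R₁ := TV and R₂ := 0. Let A be a nonempty proper subset of V, set f⁰ := 1_A / G(1_A)^{1/p}, fix c ≥ 0 and subgradients s₁ ∈ ∂S₁(f⁰), g ∈ ∂G(f⁰), and let f¹ be a minimizer of Φ_{f⁰}^c over {u : G(u) ≤ 1}. Then either Φ_{f⁰}^c(f¹) = Φ_{f⁰}^c(f⁰), or there exists t ∈ ℝ such that B := {i ∈ V : f¹_i > t} satisfies ∅ ≠ B ⊊ V and cut(B, B̄)/Ŝ(B) < cut(A, Ā)/Ŝ(A).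 -/
open Finset Filter

/-- The cut value of a set `A` in the weighted graph `w`. -/
def cutF {n : ℕ} (w : Fin n → Fin n → ℝ) (A : Finset (Fin n)) : ℝ :=
  ∑ i ∈ A, ∑ j ∈ Aᶜ, w i j

/-- The graph total variation `TV f = (1/2) ∑_{i,j} w_{ij} |f_i - f_j|`. -/
noncomputable def tv {n : ℕ} (w : Fin n → Fin n → ℝ) (f : Fin n → ℝ) : ℝ :=
  (1 / 2) * ∑ i, ∑ j, w i j * |f i - f j|

/-- The indicator vector of a set `A ⊆ V`. -/
def indic {n : ℕ} (A : Finset (Fin n)) : Fin n → ℝ := fun i => if i ∈ A then 1 else 0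

/-- The Lovasz extension of a set function `Ŝ` with `Ŝ ∅ = 0`:
`S f = ∑_{i=1}^n f_i (Ŝ(C_{i-1}) - Ŝ(C_i))` where the values of `f` are sorted increasingly
and `C_i` consists of the elements at sorted positions `> i`. -/
noncomputable def lovasz {n : ℕ} (Shat : Finset (Fin n) → ℝ) (f : Fin n → ℝ) : ℝ :=
  ∑ k : Fin n, f (Tuple.sort f k) *
    (Shat (Finset.univ.filter fun j => (k : ℕ) ≤ ((Tuple.sort f).symm j : ℕ)) -
     Shat (Finset.univ.filter fun j => (k : ℕ) + 1 ≤ ((Tuple.sort f).symm j : ℕ)))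

/-- sorted values, as a sequence on `ℕ` -/
noncomputable def sv {m : ℕ} (f : Fin (m + 1) → ℝ) (k : ℕ) : ℝ :=
  if h : k < m + 1 then f (Tuple.sort f ⟨k, h⟩) else 0

/-- upper sets in sorted order -/
noncomputable def us {m : ℕ} (f : Fin (m + 1) → ℝ) (k : ℕ) : Finset (Fin (m + 1)) :=
  Finset.univ.filter fun j => k ≤ ((Tuple.sort f).symm j : ℕ)

lemma sv_mono {m : ℕ} (f : Fin (m + 1) → ℝ) {a b : ℕ} (hab : a ≤ b) (hb : b < m + 1) :
    sv f a ≤ sv f b := by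
  unfold sv
  rw [dif_pos hb, dif_pos (lt_of_le_of_lt hab hb)]
  exact Tuple.monotone_sort f (by simpa using hab)

lemma sv_pos {m : ℕ} (f : Fin (m + 1) → ℝ) (j : Fin (m + 1)) :
    sv f ((Tuple.sort f).symm j : ℕ) = f j := by
  unfold sv
  rw [dif_pos (Fin.isLt _)]
  simp

lemma sv_exists {m : ℕ} (f : Fin (m + 1) → ℝ) {k : ℕ} (hk : k < m + 1) :
    ∃ j, sv f k = f j := by
  unfold sv
  rw [dif_pos hk]
  exact ⟨_, rfl⟩

lemma sv_decomp {m : ℕ} (f : Fin (m + 1) → ℝ) (j : Fin (m + 1)) :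
    f j = sv f 0 + ∑ k ∈ range m, (sv f (k + 1) - sv f k) * indic (us f (k + 1)) j := by
  have key : ∀ M q : ℕ, q ≤ M → ∑ k ∈ range M, (sv f (k + 1) - sv f k) *
      (if k + 1 ≤ q then (1 : ℝ) else 0) = sv f q - sv f 0 := by
    intro M q hq
    have h1 : ∀ k ∈ range M, (sv f (k + 1) - sv f k) * (if k + 1 ≤ q then (1 : ℝ) else 0)
        = if k < q then (sv f (k + 1) - sv f k) else 0 := by
      intro k _
      by_cases h : k < q
      · rw [if_pos h, if_pos (by omega)]; ring
      · rw [if_neg h, if_neg (by omega)]; ring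
    rw [Finset.sum_congr rfl h1, ← Finset.sum_filter]
    have : (range M).filter (fun k => k < q) = range q := by
      ext k; simp; omega
    rw [this, Finset.sum_range_sub]
  have h := key m ((Tuple.sort f).symm j : ℕ) (by have := ((Tuple.sort f).symm j).isLt; omega)
  rw [sv_pos] at h
  have h2 : ∑ k ∈ range m, (sv f (k + 1) - sv f k) * indic (us f (k + 1)) j = f j - sv f 0 := by
    rw [← h]
    refine Finset.sum_congr rfl fun k _ => ?_
    simp [indic, us]
  linarith

lemma abel_aux (x T : ℕ → ℝ) (M : ℕ) :
    ∑ k ∈ range (M + 1), x k * (T k - T (k + 1)) =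
      x 0 * T 0 - x M * T (M + 1) + ∑ k ∈ range M, (x (k + 1) - x k) * T (k + 1) := by
  induction M with
  | zero => simp; ring
  | succ M ih =>
    rw [Finset.sum_range_succ, ih, Finset.sum_range_succ (fun k => (x (k + 1) - x k) * T (k + 1))]
    ring

lemma lovasz_eq {m : ℕ} (T : Finset (Fin (m + 1)) → ℝ) (hu : T Finset.univ = 0) (he : T ∅ = 0)
    (f : Fin (m + 1) → ℝ) :
    lovasz T f = ∑ k ∈ range m, (sv f (k + 1) - sv f k) * T (us f (k + 1)) := by
  have h0 : us f 0 = Finset.univ := by simp [us]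
  have h1 : us f (m + 1) = ∅ := by
    ext j; simp only [us, mem_filter, mem_univ, true_and, notMem_empty, iff_false]
    have := ((Tuple.sort f).symm j).isLt; omega
  have h := abel_aux (sv f) (fun k => T (us f k)) m
  simp only [h0, h1, hu, he] at h
  rw [← Fin.sum_univ_eq_sum_range (fun k => sv f k * (T (us f k) - T (us f (k + 1))))] at h
  have h2 : lovasz T f = ∑ i : Fin (m + 1), sv f i * (T (us f i) - T (us f (i + 1))) := by
    unfold lovasz
    refine Finset.sum_congr rfl fun k _ => ?_
    have hk : sv f k = f (Tuple.sort f k) := by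
      unfold sv
      rw [dif_pos k.isLt]
    rw [hk]
    rfl
  rw [h2, h]; ring

lemma us_eq {m : ℕ} (f : Fin (m + 1) → ℝ) {k : ℕ} (hk : k < m) (hlt : sv f k < sv f (k + 1)) :
    us f (k + 1) = Finset.univ.filter fun i => sv f k < f i := by
  ext j
  simp only [us, mem_filter, mem_univ, true_and]
  have hj := ((Tuple.sort f).symm j).isLt
  constructor
  · intro h
    have := sv_mono f h hj
    rw [sv_pos] at this
    linarith
  · intro h
    by_contra hc
    have := sv_mono f (show ((Tuple.sort f).symm j : ℕ) ≤ k by omega) (by omega)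
    rw [sv_pos] at this
    linarith

lemma lovasz_indic {m : ℕ} (T : Finset (Fin (m + 1)) → ℝ) (hu : T Finset.univ = 0) (he : T ∅ = 0)
    (A : Finset (Fin (m + 1))) (hA : A.Nonempty) (hA' : A ≠ Finset.univ) :
    lovasz T (indic A) = T A := by
  rw [lovasz_eq T hu he]
  have hval : ∀ k, k < m + 1 → sv (indic A) k = 0 ∨ sv (indic A) k = 1 := by
    intro k hk
    obtain ⟨j, hj⟩ := sv_exists (indic A) hk
    rw [hj]; unfold indic; split_ifs <;> simp
  have h1 : ∀ k ∈ range m, (sv (indic A) (k + 1) - sv (indic A) k) * T (us (indic A) (k + 1))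
      = (sv (indic A) (k + 1) - sv (indic A) k) * T A := by
    intro k hk
    have hk := mem_range.1 hk
    rcases (sv_mono (indic A) (Nat.le_succ k) (by omega)).eq_or_lt with h | h
    · simp only [Nat.succ_eq_add_one] at h
      rw [h]; ring
    · rw [us_eq _ hk h]
      have h0 : sv (indic A) k = 0 := by
        rcases hval k (by omega) with h0 | h0
        · exact h0
        · rcases hval (k + 1) (by omega) with h2 | h2 <;>
          · simp only [Nat.succ_eq_add_one] at h
            linarith
      congr 2
      ext i
      simp only [h0, mem_filter, mem_univ, true_and, indic]
      split_ifs with hi <;> simp [hi]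
  rw [Finset.sum_congr rfl h1, ← Finset.sum_mul, Finset.sum_range_sub]
  obtain ⟨i, hi⟩ := hA
  obtain ⟨i', hi'⟩ : ∃ i', i' ∉ A := by
    by_contra hc
    push Not at hc
    exact hA' (Finset.eq_univ_of_forall hc)
  have hx0 : sv (indic A) 0 = 0 := by
    have := sv_mono (indic A) (Nat.zero_le _) ((Tuple.sort (indic A)).symm i').isLt
    rw [sv_pos] at this
    have hv : indic A i' = 0 := by simp [indic, hi']
    rw [hv] at this
    rcases hval 0 (by omega) with h | h
    · exact h
    · linarith
  have hxm : sv (indic A) m = 1 := by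
    have := sv_mono (indic A) (show ((Tuple.sort (indic A)).symm i : ℕ) ≤ m by
      have := ((Tuple.sort (indic A)).symm i).isLt; omega) (by omega)
    rw [sv_pos] at this
    have hv : indic A i = 1 := by simp [indic, hi]
    rw [hv] at this
    rcases hval m (by omega) with h | h
    · linarith
    · exact h
  rw [hx0, hxm]; ring

lemma tv_indic {n : ℕ} (w : Fin n → Fin n → ℝ) (hwsym : ∀ i j, w i j = w j i)
    (A : Finset (Fin n)) : tv w (indic A) = cutF w A := by
  have hc : cutF w A = ∑ i, ∑ j, w i j * (indic A i * (1 - indic A j)) := by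
    unfold cutF
    rw [← Finset.sum_filter_add_sum_filter_not Finset.univ (fun i => i ∈ A)]
    have h2 : ∑ i ∈ Finset.univ.filter (fun i => i ∉ A),
        ∑ j, w i j * (indic A i * (1 - indic A j)) = 0 := by
      refine Finset.sum_eq_zero fun i hi => Finset.sum_eq_zero fun j _ => ?_
      have : i ∉ A := by simpa using hi
      simp [indic, this]
    rw [h2, add_zero]
    have h3 : Finset.univ.filter (fun i => i ∈ A) = A := by ext; simp
    rw [h3]
    refine Finset.sum_congr rfl fun i hi => ?_
    rw [← Finset.sum_subset (Finset.subset_univ Aᶜ)]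
    · refine Finset.sum_congr rfl fun j hj => ?_
      have : j ∉ A := by simpa using hj
      simp [indic, hi, this]
    · intro j _ hj
      have : j ∈ A := by simpa using hj
      simp [indic, this]
  have hc' : cutF w A = ∑ i, ∑ j, w i j * (indic A j * (1 - indic A i)) := by
    rw [hc, Finset.sum_comm]
    exact Finset.sum_congr rfl fun i _ => Finset.sum_congr rfl fun j _ => by rw [hwsym]
  have : ∑ i, ∑ j, w i j * |indic A i - indic A j| = cutF w A + cutF w A := by
    conv_rhs => rw [hc]
    conv_rhs => arg 2; rw [← hc, hc']
    rw [← Finset.sum_add_distrib]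
    refine Finset.sum_congr rfl fun i _ => ?_
    rw [← Finset.sum_add_distrib]
    refine Finset.sum_congr rfl fun j _ => ?_
    unfold indic
    split_ifs <;> simp
  unfold tv
  rw [this]; ring

lemma abs_decomp {m : ℕ} (f : Fin (m + 1) → ℝ) (i j : Fin (m + 1)) :
    |f i - f j| = ∑ k ∈ range m, (sv f (k + 1) - sv f k) *
      |indic (us f (k + 1)) i - indic (us f (k + 1)) j| := by
  have main : ∀ i j : Fin (m + 1), ((Tuple.sort f).symm i : ℕ) ≤ ((Tuple.sort f).symm j : ℕ) →
      |f i - f j| = ∑ k ∈ range m, (sv f (k + 1) - sv f k) *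
      |indic (us f (k + 1)) i - indic (us f (k + 1)) j| := by
    intro i j hij
    have hle : f i ≤ f j := by
      rw [← sv_pos f i, ← sv_pos f j]; exact sv_mono f hij (Fin.isLt _)
    rw [abs_of_nonpos (by linarith)]
    have h : ∀ k ∈ range m, (sv f (k + 1) - sv f k) *
        |indic (us f (k + 1)) i - indic (us f (k + 1)) j| =
        (sv f (k + 1) - sv f k) * indic (us f (k + 1)) j -
        (sv f (k + 1) - sv f k) * indic (us f (k + 1)) i := by
      intro k _
      have : indic (us f (k + 1)) i ≤ indic (us f (k + 1)) j := by
        simp only [indic, us, mem_filter, mem_univ, true_and]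
        split_ifs <;> first | omega | norm_num
      rw [abs_of_nonpos (by linarith)]; ring
    rw [Finset.sum_congr rfl h, Finset.sum_sub_distrib]
    have := sv_decomp f i
    have := sv_decomp f j
    linarith
  rcases le_total ((Tuple.sort f).symm i : ℕ) ((Tuple.sort f).symm j : ℕ) with h | h
  · exact main i j h
  · rw [abs_sub_comm, main j i h]
    exact Finset.sum_congr rfl fun k _ => by rw [abs_sub_comm]

lemma tv_decomp {m : ℕ} (w : Fin (m + 1) → Fin (m + 1) → ℝ) (hwsym : ∀ i j, w i j = w j i)
    (f : Fin (m + 1) → ℝ) :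
    tv w f = ∑ k ∈ range m, (sv f (k + 1) - sv f k) * cutF w (us f (k + 1)) := by
  simp only [← tv_indic w hwsym]
  unfold tv
  simp only [abs_decomp f, Finset.mul_sum]
  conv_rhs => rw [Finset.sum_comm]
  refine Finset.sum_congr rfl fun i _ => ?_
  conv_rhs => rw [Finset.sum_comm]
  refine Finset.sum_congr rfl fun j _ => ?_
  exact Finset.sum_congr rfl fun k _ => by ring

lemma tv_smul {n : ℕ} (w : Fin n → Fin n → ℝ) (a : ℝ) (ha : 0 ≤ a) (f : Fin n → ℝ) :
    tv w (a • f) = a * tv w f := by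
  unfold tv
  simp only [Finset.mul_sum]
  refine Finset.sum_congr rfl fun i _ => Finset.sum_congr rfl fun j _ => ?_
  simp only [Pi.smul_apply, smul_eq_mul]
  rw [← mul_sub, abs_mul, abs_of_nonneg ha]; ring

lemma subadd {V : Type*} (S : (V → ℝ) → ℝ) (hh : PosOneHom S) (hc : ConvexOn ℝ Set.univ S)
    (u v : V → ℝ) : S (u + v) ≤ S u + S v := by
  have h := hc.2 (Set.mem_univ u) (Set.mem_univ v) (by norm_num : (0 : ℝ) ≤ 1 / 2)
    (by norm_num : (0 : ℝ) ≤ 1 / 2) (by norm_num)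
  rw [← smul_add, hh _ (by norm_num)] at h
  simp only [smul_eq_mul] at h
  linarith

lemma subadd_sum {V : Type*} (S : (V → ℝ) → ℝ) (hh : PosOneHom S)
    (hc : ConvexOn ℝ Set.univ S) (d : ℕ → ℝ) (e : ℕ → V → ℝ) (M : ℕ) (hd : ∀ k < M, 0 ≤ d k) :
    S (∑ k ∈ range M, d k • e k) ≤ ∑ k ∈ range M, d k * S (e k) := by
  induction M with
  | zero =>
    have := hh 0 le_rfl 0
    simp at this
    simp [this]
  | succ M ih =>
    rw [Finset.sum_range_succ, Finset.sum_range_succ]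
    have h1 := subadd S hh hc (∑ k ∈ range M, d k • e k) (d M • e M)
    rw [hh _ (hd M (by omega))] at h1
    have := ih fun k hk => hd k (by omega)
    linarith

lemma ip_sub_right {V : Type*} [Fintype V] (a u v : V → ℝ) : ip a (u - v) = ip u a - ip v a := by
  unfold ip
  rw [← Finset.sum_sub_distrib]
  exact Finset.sum_congr rfl fun i _ => by simp only [Pi.sub_apply]; ring

lemma ip_smul_left {V : Type*} [Fintype V] (t : ℝ) (u a : V → ℝ) : ip (t • u) a = t * ip u a := by
  unfold ip
  rw [Finset.mul_sum]
  exact Finset.sum_congr rfl fun i _ => by simp only [Pi.smul_apply, smul_eq_mul]; ring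

/-- improvement theorem: starting RatioDCA-prox from the (normalized)
indicator of a partition `(A, Ā)`, one step either terminates
(`Φ(f¹) = Φ(f⁰)`) or strictly improves the balanced cut after optimal thresholding. -/
theorem ratioDCA_prox_improvement {n : ℕ} (w : Fin n → Fin n → ℝ)
    (hwsym : ∀ i j, w i j = w j i) (hwnonneg : ∀ i j, 0 ≤ w i j)
    (p : ℝ) (hp : 1 ≤ p)
    (S1 S2 G : (Fin n → ℝ) → ℝ) (Shat : Finset (Fin n) → ℝ)
    (hS1conv : ConvexOn ℝ Set.univ S1) (hS2conv : ConvexOn ℝ Set.univ S2)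
    (hS1hom : PosOneHom S1) (hS2hom : PosOneHom S2)
    (hcond :
      (PosOneHom (fun u => S1 u - S2 u) ∧
        (∀ f : Fin n → ℝ, S1 (-f) - S2 (-f) = S1 f - S2 f) ∧
        ConvexOn ℝ Set.univ (fun u => S1 u - S2 u) ∧
        (∀ (f : Fin n → ℝ) (α : ℝ),
          S1 (fun i => f i + α) - S2 (fun i => f i + α) = S1 f - S2 f) ∧
        (∀ A : Finset (Fin n), Shat A = S1 (indic A) - S2 (indic A))) ∨
      ((∀ A, 0 ≤ Shat A) ∧ (∀ A : Finset (Fin n), Shat Aᶜ = Shat A) ∧ Shat ∅ = 0 ∧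
        (∀ f : Fin n → ℝ, S1 f - S2 f = lovasz Shat f)))
    (hShatpos : ∀ B : Finset (Fin n), B.Nonempty → B ≠ Finset.univ → 0 < Shat B)
    (hGconv : ConvexOn ℝ Set.univ G) (hGnonneg : ∀ u, 0 ≤ G u)
    (hGhom : PosPHom p G) (hGzero : ∀ u, G u = 0 ↔ u = 0)
    (A : Finset (Fin n)) (hA : A.Nonempty) (hAproper : A ≠ Finset.univ)
    (f0 : Fin n → ℝ) (hf0 : f0 = (G (indic A) ^ ((1 : ℝ) / p))⁻¹ • indic A)
    (c : ℝ) (hc : 0 ≤ c)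
    (s1 : Fin n → ℝ) (hs1 : s1 ∈ subdiff S1 f0)
    (g : Fin n → ℝ) (hg : g ∈ subdiff G f0)
    (f1 : Fin n → ℝ) (hf1mem : G f1 ≤ 1)
    (hf1min : ∀ u, G u ≤ 1 →
      tv w f1 + tv w f0 / (S1 f0 - S2 f0) * (S2 f1 - ip f1 s1) - c * ip f1 g ≤
        tv w u + tv w f0 / (S1 f0 - S2 f0) * (S2 u - ip u s1) - c * ip u g) :
    (tv w f1 + tv w f0 / (S1 f0 - S2 f0) * (S2 f1 - ip f1 s1) - c * ip f1 g =
        tv w f0 + tv w f0 / (S1 f0 - S2 f0) * (S2 f0 - ip f0 s1) - c * ip f0 g) ∨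
      ∃ t : ℝ,
        (Finset.univ.filter fun i => t < f1 i).Nonempty ∧
        (Finset.univ.filter fun i => t < f1 i) ≠ Finset.univ ∧
        cutF w (Finset.univ.filter fun i => t < f1 i) /
            Shat (Finset.univ.filter fun i => t < f1 i) <
          cutF w A / Shat A := by
  obtain _ | m := n
  · obtain ⟨i, _⟩ := hA
    exact i.elim0
  -- values of `S` at indicators
  have hSind : S1 (indic A) - S2 (indic A) = Shat A := by
    rcases hcond with ⟨_, _, _, _, h⟩ | ⟨_, hsym, he, h⟩
    · rw [h]
    · rw [h]
      exact lovasz_indic Shat (by rw [← Finset.compl_empty, hsym, he]) he A hA hAproper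
  have hSle : S1 f1 - S2 f1 ≤
      ∑ k ∈ range m, (sv f1 (k + 1) - sv f1 k) * Shat (us f1 (k + 1)) := by
    rcases hcond with ⟨hh, _, hcv, hshift, h⟩ | ⟨_, hsym, he, h⟩
    · have h1 := subadd_sum (fun u => S1 u - S2 u) hh hcv (fun k => sv f1 (k + 1) - sv f1 k)
        (fun k => indic (us f1 (k + 1))) m
        (fun k hk => by have := sv_mono f1 (Nat.le_succ k) (by omega); simp at this ⊢; linarith)
      have h2 := hshift (∑ k ∈ range m, (sv f1 (k + 1) - sv f1 k) • indic (us f1 (k + 1))) (sv f1 0)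
      have h3 : (fun i => (∑ k ∈ range m, (sv f1 (k + 1) - sv f1 k) • indic (us f1 (k + 1))) i
          + sv f1 0) = f1 := by
        funext i
        rw [sv_decomp f1 i, add_comm]
        simp [Finset.sum_apply]
      rw [h3] at h2
      simp only [← h] at h1
      linarith
    · rw [h, lovasz_eq Shat (by rw [← Finset.compl_empty, hsym, he]) he]
  have hSA := hShatpos A hA hAproper
  have hcut0 : ∀ B, 0 ≤ cutF w B := fun B =>
    Finset.sum_nonneg fun i _ => Finset.sum_nonneg fun j _ => hwnonneg i j
  have hind : indic A ≠ 0 := by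
    obtain ⟨i, hi⟩ := hA
    intro h
    have := congrFun h i
    simp [indic, hi] at this
  have hGA : 0 < G (indic A) :=
    lt_of_le_of_ne (hGnonneg _) fun h => hind ((hGzero _).1 h.symm)
  have hb : 0 < (G (indic A) ^ ((1 : ℝ) / p))⁻¹ := inv_pos.2 (Real.rpow_pos_of_pos hGA _)
  have hGf0 : G f0 = 1 := by
    rw [hf0, hGhom _ hb.le, Real.inv_rpow (Real.rpow_nonneg hGA.le _), ← Real.rpow_mul hGA.le,
      one_div, inv_mul_cancel₀ (by linarith), Real.rpow_one, inv_mul_cancel₀ hGA.ne']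
  have hγ : tv w f0 / (S1 f0 - S2 f0) = cutF w A / Shat A := by
    rw [hf0, tv_smul w _ hb.le, hS1hom _ hb.le, hS2hom _ hb.le, ← mul_sub, hSind,
      tv_indic w hwsym, mul_div_mul_left _ _ hb.ne']
  have hSf0 : 0 < S1 f0 - S2 f0 := by
    rw [hf0, hS1hom _ hb.le, hS2hom _ hb.le, ← mul_sub, hSind]
    positivity
  have htv0 : tv w f0 = tv w f0 / (S1 f0 - S2 f0) * (S1 f0 - S2 f0) := by
    field_simp
  have hγ0 : 0 ≤ cutF w A / Shat A := div_nonneg (hcut0 A) hSA.le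
  rw [hγ] at hf1min htv0 ⊢
  set γ := cutF w A / Shat A with hγdef
  rcases (hf1min f0 hGf0.le).eq_or_lt with heq | hlt
  · exact Or.inl heq
  right
  -- subgradient identities
  have hs : ∀ u, S1 f0 + (ip u s1 - ip f0 s1) ≤ S1 u := fun u => by
    rw [← ip_sub_right]; exact hs1 u
  have hgg : G f0 + (ip f1 g - ip f0 g) ≤ G f1 := by
    rw [← ip_sub_right]; exact hg f1
  have hs0 : ip f0 s1 = S1 f0 := by
    have h2 := hs ((2 : ℝ) • f0)
    have h0 := hs ((0 : ℝ) • f0)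
    rw [hS1hom _ (by norm_num), ip_smul_left] at h2 h0
    linarith
  have hs2 := hs f1
  have hneg : tv w f1 - γ * (S1 f1 - S2 f1) < 0 := by
    have e1 : γ * ip f1 s1 ≤ γ * S1 f1 := mul_le_mul_of_nonneg_left (by linarith) hγ0
    have e2 : c * ip f1 g ≤ c * ip f0 g := mul_le_mul_of_nonneg_left (by linarith) hc
    rw [hs0] at hlt
    linarith
  by_contra hno
  push Not at hno
  have hterm : ∑ k ∈ range m, (sv f1 (k + 1) - sv f1 k) * (γ * Shat (us f1 (k + 1))) ≤ tv w f1 := by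
    rw [tv_decomp w hwsym]
    refine Finset.sum_le_sum fun k hk => ?_
    have hk := mem_range.1 hk
    have hmono : sv f1 k ≤ sv f1 (k + 1) := sv_mono f1 (Nat.le_succ k) (by omega)
    rcases hmono.eq_or_lt with h | h
    · rw [h]; simp
    · refine mul_le_mul_of_nonneg_left ?_ (by linarith)
      rw [us_eq f1 hk h]
      have hne : (Finset.univ.filter fun i => sv f1 k < f1 i).Nonempty := by
        obtain ⟨j, hj⟩ := sv_exists f1 (show k + 1 < m + 1 by omega)
        exact ⟨j, by simp [← hj, h]⟩
      have hnu : (Finset.univ.filter fun i => sv f1 k < f1 i) ≠ Finset.univ := by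
        obtain ⟨j, hj⟩ := sv_exists f1 (show k < m + 1 by omega)
        intro hu
        have : j ∈ Finset.univ.filter fun i => sv f1 k < f1 i := by rw [hu]; simp
        simp [hj] at this
      exact (le_div_iff₀ (hShatpos _ hne hnu)).1 (hno (sv f1 k) hne hnu)
  have hfin := mul_le_mul_of_nonneg_left hSle hγ0
  rw [Finset.mul_sum] at hfin
  have : ∑ k ∈ range m, γ * ((sv f1 (k + 1) - sv f1 k) * Shat (us f1 (k + 1))) =
      ∑ k ∈ range m, (sv f1 (k + 1) - sv f1 k) * (γ * Shat (us f1 (k + 1))) :=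
    Finset.sum_congr rfl fun k _ => by ring
  linarith
end
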